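/- arXiv:2311.09332 — 3 statements merged into one kernel-verified Lean document; each statement's English description precedes it below -/
import Mathlib

section
/- Let f : ℝ → ℝ be infinitely differentiable and let x ∈ ℝ. Define H(y, Δx) = f(y) − (1/24)·f″(y)·Δx² + (7/5760)·f⁽⁴⁾(y)·Δx⁴. Then, for each choice of sign, H(x ± Δx/2, Δx) = f(x) ± (1/2)·f′(x)·Δx + (1/12)·f″(x)·Δx² − (1/720)·f⁽⁴⁾(x)·Δx⁴ + O(Δx⁶) as Δx → 0⁺; in particular the coefficients of Δx³ and Δx⁵ vanish. -/
theorem aux_taylor (g : ℝ → ℝ) (hg : ContDiff ℝ (⊤ : ℕ∞) g) (x : ℝ) (n : ℕ) :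
    ∃ C > (0 : ℝ), ∃ δ > (0 : ℝ), ∀ h : ℝ, |h| < δ →
      |g (x + h) - ∑ k ∈ Finset.range n, iteratedDeriv k g x / (k.factorial : ℝ) * h ^ k|
        ≤ C * |h| ^ n := by
  have h1 := taylor_isLittleO_univ (x₀ := x) (n := n) (hg.of_le (by exact_mod_cast le_top))
  have h2 := h1.bound (c := 1) one_pos
  rw [Metric.eventually_nhds_iff] at h2
  obtain ⟨δ, hδ, h2⟩ := h2
  refine ⟨1 + |iteratedDeriv n g x / (n.factorial : ℝ)|, by positivity, δ, hδ, fun h hh => ?_⟩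
  have h3 := h2 (y := x + h) (by simpa [Real.dist_eq] using hh)
  rw [taylor_within_apply, Finset.sum_range_succ] at h3
  simp only [iteratedDerivWithin_univ, add_sub_cancel_left, smul_eq_mul, Real.norm_eq_abs,
    abs_pow, one_mul] at h3
  have e : ∀ k : ℕ, ((k.factorial : ℝ)⁻¹ * h ^ k) * iteratedDeriv k g x
      = iteratedDeriv k g x / (k.factorial : ℝ) * h ^ k := fun k => by
    rw [div_eq_mul_inv]; ring
  simp only [e] at h3
  set S := ∑ k ∈ Finset.range n, iteratedDeriv k g x / (k.factorial : ℝ) * h ^ k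
  set T := iteratedDeriv n g x / (n.factorial : ℝ)
  calc |g (x + h) - S| = |(g (x + h) - (S + T * h ^ n)) + T * h ^ n| := by congr 1; ring
    _ ≤ |g (x + h) - (S + T * h ^ n)| + |T * h ^ n| := abs_add_le _ _
    _ ≤ |h| ^ n + |T| * |h| ^ n := by rw [abs_mul, abs_pow]; gcongr
    _ = _ := by ring

theorem aux_key (f : ℝ → ℝ) (hf : ContDiff ℝ (⊤ : ℕ∞) f) (x : ℝ) :
    ∃ C > (0 : ℝ), ∃ δ > (0 : ℝ), ∀ h : ℝ, |h| < δ →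
      |f (x + h) - (1 / 24) * iteratedDeriv 2 f (x + h) * (2 * h) ^ 2
          + (7 / 5760) * iteratedDeriv 4 f (x + h) * (2 * h) ^ 4 -
        (f x + deriv f x * h + (1 / 12) * iteratedDeriv 2 f x * (2 * h) ^ 2
          - (1 / 720) * iteratedDeriv 4 f x * (2 * h) ^ 4)| ≤ C * |h| ^ 6 := by
  have hd : ∀ m : ℕ, ContDiff ℝ (⊤ : ℕ∞) (iteratedDeriv m f) := fun m => by
    rw [iteratedDeriv_eq_iterate]
    exact ContDiff.iterate_deriv m hf
  have hc : ∀ k m : ℕ, iteratedDeriv k (iteratedDeriv m f) = iteratedDeriv (k + m) f := fun k m => by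
    simp only [iteratedDeriv_eq_iterate, Function.iterate_add_apply]
  obtain ⟨A, hA, a, ha, h0⟩ := aux_taylor f hf x 6
  obtain ⟨B, hB, b, hb, h2⟩ := aux_taylor _ (hd 2) x 4
  obtain ⟨D, hD, d, hd', h4⟩ := aux_taylor _ (hd 4) x 2
  refine ⟨A + B + D, by positivity, min a (min b d), by positivity, fun h hh => ?_⟩
  simp only [lt_min_iff] at hh
  have h0 := h0 h hh.1
  have h2 := h2 h hh.2.1
  have h4 := h4 h hh.2.2
  simp only [hc, Finset.sum_range_succ, Finset.sum_range_zero, Nat.factorial, Nat.reduceAdd] at h0 h2 h4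
  norm_num at h0 h2 h4
  generalize hR0 : f (x + h) - _ = R0 at h0
  generalize hR2 : iteratedDeriv 2 f (x + h) - _ = R2 at h2
  generalize hR4 : iteratedDeriv 4 f (x + h) - _ = R4 at h4
  rw [sub_eq_iff_eq_add] at hR0 hR2 hR4
  rw [hR0, hR2, hR4]
  have e2 : |1 / 6 * h ^ 2 * R2| ≤ B * |h| ^ 6 := by
    rw [abs_mul, abs_mul, abs_pow]
    calc |(1 / 6 : ℝ)| * |h| ^ 2 * |R2| ≤ 1 * |h| ^ 2 * (B * |h| ^ 4) := by
          gcongr; norm_num [abs_of_pos]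
      _ = _ := by ring
  have e4 : |7 / 360 * h ^ 4 * R4| ≤ D * |h| ^ 6 := by
    rw [abs_mul, abs_mul, abs_pow]
    calc |(7 / 360 : ℝ)| * |h| ^ 4 * |R4| ≤ 1 * |h| ^ 4 * (D * |h| ^ 2) := by
          have : |R4| ≤ D * |h| ^ 2 := by simpa using h4
          gcongr; norm_num [abs_of_pos]
      _ = _ := by ring
  calc _ = |R0 - 1 / 6 * h ^ 2 * R2 + 7 / 360 * h ^ 4 * R4| := by congr 1; ring
    _ ≤ |R0 - 1 / 6 * h ^ 2 * R2| + |7 / 360 * h ^ 4 * R4| := abs_add_le _ _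
    _ ≤ |R0| + |1 / 6 * h ^ 2 * R2| + |7 / 360 * h ^ 4 * R4| := by gcongr; exact abs_sub _ _
    _ ≤ A * |h| ^ 6 + B * |h| ^ 6 + D * |h| ^ 6 := by gcongr
    _ = _ := by ring

/-- For smooth `f` and
`H(y, Δx) = f(y) − (1/24)·f″(y)·Δx² + (7/5760)·f⁽⁴⁾(y)·Δx⁴`, one has, for each sign,
`H(x ± Δx/2, Δx) = f(x) ± (1/2)f′(x)Δx + (1/12)f″(x)Δx² − (1/720)f⁽⁴⁾(x)Δx⁴ + O(Δx⁶)`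
as `Δx → 0⁺` (the coefficients of `Δx³` and `Δx⁵` vanish). -/
theorem weno_flux_taylor_at_cell_boundaries
    (f : ℝ → ℝ) (hf : ContDiff ℝ (⊤ : ℕ∞) f) (x : ℝ)
    (H : ℝ → ℝ → ℝ)
    (hH : ∀ y Δx : ℝ, H y Δx =
      f y - (1 / 24) * iteratedDeriv 2 f y * Δx ^ 2
          + (7 / 5760) * iteratedDeriv 4 f y * Δx ^ 4) :
    ∃ C > (0 : ℝ), ∃ δ > (0 : ℝ), ∀ Δx : ℝ, 0 < Δx → Δx < δ →
      |H (x + Δx / 2) Δx -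
        (f x + (1 / 2) * deriv f x * Δx + (1 / 12) * iteratedDeriv 2 f x * Δx ^ 2
          - (1 / 720) * iteratedDeriv 4 f x * Δx ^ 4)| ≤ C * Δx ^ 6 ∧
      |H (x - Δx / 2) Δx -
        (f x - (1 / 2) * deriv f x * Δx + (1 / 12) * iteratedDeriv 2 f x * Δx ^ 2
          - (1 / 720) * iteratedDeriv 4 f x * Δx ^ 4)| ≤ C * Δx ^ 6 := by
  obtain ⟨C, hC, δ, hδ, h⟩ := aux_key f hf x
  refine ⟨C, hC, δ, hδ, fun t ht htδ => ?_⟩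
  have hle : C * (t / 2) ^ 6 ≤ C * t ^ 6 := by gcongr; linarith
  have h1 := h (t / 2) (by rw [abs_of_pos (by positivity)]; linarith)
  have h2 := h (-(t / 2)) (by rw [abs_neg, abs_of_pos (by positivity)]; linarith)
  rw [abs_of_pos (by positivity : 0 < t / 2)] at h1
  rw [abs_neg (t / 2), abs_of_pos (by positivity : 0 < t / 2), ← sub_eq_add_neg] at h2
  rw [hH, hH]
  constructor
  · refine le_trans (le_of_eq ?_) (h1.trans hle)
    congr 1; ring
  · refine le_trans (le_of_eq ?_) (h2.trans hle)
    congr 1; ring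
end

section
/- Let f : ℝ → ℝ be infinitely differentiable and let x ∈ ℝ. Then, as Δx → 0⁺ (all derivatives evaluated at x): β₂⁻(x,Δx) − β₀⁻(x,Δx) = ((13/3)f″f‴ − f′f⁽⁴⁾)Δx⁵ − ((13/3)(f‴)² + (10/3)f″f⁽⁴⁾ − f′f⁽⁵⁾)Δx⁶ + ((319/36)f‴f⁽⁴⁾ + (9/4)f″f⁽⁵⁾ − (2/3)f′f⁽⁶⁾)Δx⁷ + O(Δx⁸); in particular τ⁻(x,Δx) = |β₂⁻(x,Δx) − β₀⁻(x,Δx)| = O(Δx⁵). -/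
/-- The Jiang--Shu smoothness indicators `β₀, β₁, β₂`. -/
noncomputable def wenoBeta (f : ℝ → ℝ) (x Δx : ℝ) : Fin 3 → ℝ
  | 0 => (1 / 4) * (f (x - 2 * Δx) - 4 * f (x - Δx) + 3 * f x) ^ 2
       + (13 / 12) * (f (x - 2 * Δx) - 2 * f (x - Δx) + f x) ^ 2
  | 1 => (1 / 4) * (f (x + Δx) - f (x - Δx)) ^ 2
       + (13 / 12) * (f (x - Δx) - 2 * f x + f (x + Δx)) ^ 2
  | 2 => (1 / 4) * (3 * f x - 4 * f (x + Δx) + f (x + 2 * Δx)) ^ 2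
       + (13 / 12) * (f x - 2 * f (x + Δx) + f (x + 2 * Δx)) ^ 2


noncomputable def wenoQ (d1 d2 d3 d4 d5 d6 h rm3 rm2 rm1 rp1 : ℝ) : ℝ :=
    (-41/36)*d2*d6*h^0 + (-19/3)*d3*d5*h^0 + (-175/36)*d4*d4*h^0 + (3793/1080)*d3*d6*h^1 + (1723/240)*d4*d5*h^1 + (-583/144)*d4*d6*h^2 + (-643/240)*d5*d5*h^2 + (4381/1440)*d5*d6*h^3 + (-11231/12960)*d6*d6*h^4
    + (1/4)*(2*((-2)*d1*h^0 + (2)*d2*h^1 + (-1/3)*d3*h^2 + (1/6)*d4*h^3 + (-1/60)*d5*h^4 + (1/180)*d6*h^5)*((-3)*rm1 + (1)*rp1) + h^6*((-3)*rm1 + (1)*rp1)^2)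
    + (13/12)*(2*((1)*d2*h^1 + (1/12)*d4*h^3 + (1/360)*d6*h^5)*((-1)*rm1 + (1)*rp1) + h^6*((-1)*rm1 + (1)*rp1)^2)
    - (1/4)*(2*((2)*d1*h^0 + (-2)*d2*h^1 + (1/3)*d3*h^2 + (5/6)*d4*h^3 + (-59/60)*d5*h^4 + (119/180)*d6*h^5)*((-2187)*rm3 + (512)*rm2 + (-3)*rm1) + h^6*((-2187)*rm3 + (512)*rm2 + (-3)*rm1)^2)
    - (13/12)*(2*((1)*d2*h^1 + (-2)*d3*h^2 + (25/12)*d4*h^3 + (-3/2)*d5*h^4 + (301/360)*d6*h^5)*((-2187)*rm3 + (256)*rm2 + (-1)*rm1) + h^6*((-2187)*rm3 + (256)*rm2 + (-1)*rm1)^2)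

lemma taylor_aux (f : ℝ → ℝ) (hf : ContDiff ℝ (⊤ : ℕ∞) f) (x : ℝ) :
    ∃ M > (0 : ℝ), ∃ δ > (0 : ℝ), ∀ h : ℝ, |h| < δ → ∃ r : ℝ, r ∈ Set.Icc (-M) M ∧
      f (x + h) = f x + deriv f x * h + iteratedDeriv 2 f x * h ^ 2 / 2
        + iteratedDeriv 3 f x * h ^ 3 / 6 + iteratedDeriv 4 f x * h ^ 4 / 24
        + iteratedDeriv 5 f x * h ^ 5 / 120 + iteratedDeriv 6 f x * h ^ 6 / 720 + r * h ^ 7 := by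
  have h1 := taylor_isLittleO_univ (x₀ := x) (n := 7) (contDiff_infty.1 hf 7)
  have h2 := h1.bound (c := 1) one_pos
  rw [Metric.eventually_nhds_iff] at h2
  obtain ⟨δ, hδ, H⟩ := h2
  refine ⟨|iteratedDeriv 7 f x| / 5040 + 1, by positivity, δ, hδ, fun h hh => ?_⟩
  have H1 := H (y := x + h) (by simpa [Real.dist_eq] using hh)
  simp only [taylor_within_apply, Finset.sum_range_succ, Finset.sum_range_zero,
    iteratedDerivWithin_univ, iteratedDeriv_zero, iteratedDeriv_one, Nat.factorial,
    add_sub_cancel_left, smul_eq_mul, Real.norm_eq_abs, one_mul] at H1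
  norm_num at H1
  rcases eq_or_ne h 0 with rfl | hne
  · exact ⟨0, ⟨by linarith [abs_nonneg (iteratedDeriv 7 f x)], by positivity⟩, by simp⟩
  set S := f (x + h) - (f x + deriv f x * h + iteratedDeriv 2 f x * h ^ 2 / 2
        + iteratedDeriv 3 f x * h ^ 3 / 6 + iteratedDeriv 4 f x * h ^ 4 / 24
        + iteratedDeriv 5 f x * h ^ 5 / 120 + iteratedDeriv 6 f x * h ^ 6 / 720) with hS
  have hp : 0 < |h| ^ 7 := by positivity
  refine ⟨S / h ^ 7, ?_, ?_⟩
  · rw [Set.mem_Icc, ← abs_le, abs_div, abs_pow, div_le_iff₀ hp]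
    have e : S = (S - iteratedDeriv 7 f x * h ^ 7 / 5040) + iteratedDeriv 7 f x * h ^ 7 / 5040 := by
      ring
    have b1 : |S - iteratedDeriv 7 f x * h ^ 7 / 5040| ≤ |h| ^ 7 := by
      refine le_trans (le_of_eq ?_) H1
      rw [hS]; congr 1; ring
    have b2 : |iteratedDeriv 7 f x * h ^ 7 / 5040| = |iteratedDeriv 7 f x| / 5040 * |h| ^ 7 := by
      rw [abs_div, abs_mul, abs_pow, abs_of_pos (show (0:ℝ) < 5040 by norm_num)]; ring
    rw [e]
    refine (abs_add_le _ _).trans ?_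
    rw [b2]; linarith
  · rw [div_mul_cancel₀ _ (pow_ne_zero 7 hne), hS]; ring

lemma bound_aux (F : ℝ × ℝ × ℝ × ℝ × ℝ → ℝ) (hF : Continuous F) (M : ℝ) :
    ∃ C > (0 : ℝ), ∀ h ∈ Set.Icc (0 : ℝ) 1, ∀ a ∈ Set.Icc (-M) M, ∀ b ∈ Set.Icc (-M) M,
      ∀ c ∈ Set.Icc (-M) M, ∀ d ∈ Set.Icc (-M) M, |F (h, a, b, c, d)| ≤ C := by
  have hK : IsCompact (Set.Icc (0 : ℝ) 1 ×ˢ Set.Icc (-M) M ×ˢ Set.Icc (-M) M ×ˢ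
      Set.Icc (-M) M ×ˢ Set.Icc (-M) M) :=
    isCompact_Icc.prod (isCompact_Icc.prod (isCompact_Icc.prod (isCompact_Icc.prod isCompact_Icc)))
  obtain ⟨C, hC⟩ := hK.exists_bound_of_continuousOn hF.continuousOn
  refine ⟨|C| + 1, by positivity, fun h hh a ha b hb c hc d hd => ?_⟩
  exact (hC (h, a, b, c, d) ⟨hh, ha, hb, hc, hd⟩).trans (by linarith [le_abs_self C])

/-- Taylor expansion of `β₂⁻ − β₀⁻` (left-boundary indicators
`β_k⁻(x,Δx) = β_k(x−Δx,Δx)`), and `τ⁻ = |β₂⁻ − β₀⁻| = O(Δx⁵)`. -/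
theorem weno_tau_minus_taylor
    (f : ℝ → ℝ) (hf : ContDiff ℝ (⊤ : ℕ∞) f) (x : ℝ) :
    ∃ C > (0 : ℝ), ∃ δ > (0 : ℝ), ∀ Δx : ℝ, 0 < Δx → Δx < δ →
      |(wenoBeta f (x - Δx) Δx 2 - wenoBeta f (x - Δx) Δx 0) -
        (((13 / 3) * iteratedDeriv 2 f x * iteratedDeriv 3 f x
            - deriv f x * iteratedDeriv 4 f x) * Δx ^ 5
          - ((13 / 3) * (iteratedDeriv 3 f x) ^ 2
              + (10 / 3) * iteratedDeriv 2 f x * iteratedDeriv 4 f x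
              - deriv f x * iteratedDeriv 5 f x) * Δx ^ 6
          + ((319 / 36) * iteratedDeriv 3 f x * iteratedDeriv 4 f x
              + (9 / 4) * iteratedDeriv 2 f x * iteratedDeriv 5 f x
              - (2 / 3) * deriv f x * iteratedDeriv 6 f x) * Δx ^ 7)| ≤ C * Δx ^ 8 ∧
      |wenoBeta f (x - Δx) Δx 2 - wenoBeta f (x - Δx) Δx 0| ≤ C * Δx ^ 5 := by
  
  obtain ⟨M, hM, δ, hδ, H⟩ := taylor_aux f hf x
  simp only [wenoBeta]
  generalize hd1 : deriv f x = d1 at *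
  generalize hd2 : iteratedDeriv 2 f x = d2 at *
  generalize hd3 : iteratedDeriv 3 f x = d3 at *
  generalize hd4 : iteratedDeriv 4 f x = d4 at *
  generalize hd5 : iteratedDeriv 5 f x = d5 at *
  generalize hd6 : iteratedDeriv 6 f x = d6 at *
  obtain ⟨C1, hC1, B1⟩ := bound_aux
    (fun p => wenoQ d1 d2 d3 d4 d5 d6 p.1 p.2.1 p.2.2.1 p.2.2.2.1 p.2.2.2.2)
    (by unfold wenoQ; fun_prop) M
  set K := |(13 / 3) * d2 * d3 - d1 * d4| + |(13 / 3) * d3 ^ 2 + (10 / 3) * d2 * d4 - d1 * d5|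
    + |(319 / 36) * d3 * d4 + (9 / 4) * d2 * d5 - (2 / 3) * d1 * d6| with hK
  have hK0 : 0 ≤ K := by positivity
  refine ⟨C1 + K, by positivity, min 1 (δ / 3), by positivity, fun h hh hlt => ?_⟩
  have hlt1 : h < 1 := lt_of_lt_of_le hlt (min_le_left _ _)
  have hlt2 : h < δ / 3 := lt_of_lt_of_le hlt (min_le_right _ _)
  obtain ⟨rm3, hm3, em3⟩ := H (-3 * h) (by rw [abs_lt]; constructor <;> linarith)
  obtain ⟨rm2, hm2, em2⟩ := H (-2 * h) (by rw [abs_lt]; constructor <;> linarith)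
  obtain ⟨rm1, hm1, em1⟩ := H (-1 * h) (by rw [abs_lt]; constructor <;> linarith)
  obtain ⟨rp1, hp1, ep1⟩ := H h (by rw [abs_lt]; constructor <;> linarith)
  have bQ := B1 h ⟨hh.le, hlt1.le⟩ rm3 hm3 rm2 hm2 rm1 hm1 rp1 hp1
  simp only at bQ
  rw [show x - h - 2 * h = x + -3 * h by ring, show x - h - h = x + -2 * h by ring,
    show x - h + 2 * h = x + h by ring, show x - h + h = x by ring,
    show x - h = x + -1 * h by ring, em3, em2, em1, ep1]
  generalize hQ : wenoQ d1 d2 d3 d4 d5 d6 h rm3 rm2 rm1 rp1 = Q at *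
  have h8 : h ^ 8 ≤ h ^ 5 := pow_le_pow_of_le_one hh.le hlt1.le (by norm_num)
  have h7 : h ^ 7 ≤ h ^ 5 := pow_le_pow_of_le_one hh.le hlt1.le (by norm_num)
  have h6 : h ^ 6 ≤ h ^ 5 := pow_le_pow_of_le_one hh.le hlt1.le (by norm_num)
  have main : ∀ D E : ℝ, D - E = h ^ 8 * Q → |E| ≤ K * h ^ 5 →
      |D - E| ≤ (C1 + K) * h ^ 8 ∧ |D| ≤ (C1 + K) * h ^ 5 := by
    intro D E key k2
    have k1 : |D - E| ≤ C1 * h ^ 8 := by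
      rw [key, abs_mul, abs_of_pos (by positivity : 0 < h ^ 8), mul_comm]
      gcongr
    refine ⟨k1.trans (mul_le_mul_of_nonneg_right (by linarith) (by positivity)), ?_⟩
    calc |D| = |(D - E) + E| := by rw [sub_add_cancel]
      _ ≤ |D - E| + |E| := abs_add_le _ _
      _ ≤ C1 * h ^ 5 + K * h ^ 5 := add_le_add (k1.trans (by gcongr)) k2
      _ = (C1 + K) * h ^ 5 := by ring
  refine main _ _ ?_ ?_
  · rw [← hQ]; unfold wenoQ; ring
  · rw [hK, add_mul, add_mul]
    refine (abs_add_le _ _).trans (add_le_add ((abs_sub _ _).trans (add_le_add ?_ ?_)) ?_) <;>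
      rw [abs_mul, abs_of_pos (by positivity : 0 < h ^ _)] <;> gcongr
end

section
/- Let f : ℝ → ℝ be infinitely differentiable and let x ∈ ℝ with f′(x) ≠ 0. Then, for each choice of sign, lim_{Δx → 0⁺} τ^±(x,Δx)/((τ^±(x,Δx) + β̄^±(x,Δx))·Δx³) = |(13/3)·f″(x)·f‴(x) − f′(x)·f⁽⁴⁾(x)|/f′(x)²; in particular the WENO-ZC accelerating factor satisfies τ^±/(τ^± + β̄^±) = O(Δx³) as Δx → 0⁺ in the absence of critical points. -/
open Filter Topology

/-- The global smoothness indicator `τ(x,Δx) = |β₂(x,Δx) − β₀(x,Δx)|`;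
the right-boundary version is `wenoTau f x Δx` and the left-boundary one is
`wenoTau f (x - Δx) Δx`. -/
noncomputable def wenoTau (f : ℝ → ℝ) (x Δx : ℝ) : ℝ :=
  |wenoBeta f x Δx 2 - wenoBeta f x Δx 0|

/-- The mean smoothness indicator `β̄(x,Δx) = (β₀ + β₁ + β₂)/3`. -/
noncomputable def wenoBetaBar (f : ℝ → ℝ) (x Δx : ℝ) : ℝ :=
  (wenoBeta f x Δx 0 + wenoBeta f x Δx 1 + wenoBeta f x Δx 2) / 3


lemma weno_taylor_aux (f : ℝ → ℝ) (hf : ContDiff ℝ (⊤ : ℕ∞) f) (x k : ℝ) :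
    ∃ u : ℝ → ℝ, Tendsto u (𝓝[>] 0) (𝓝 0) ∧ ∀ h : ℝ, 0 < h →
      f (x + k * h) = f x + h * (deriv f x * k + iteratedDeriv 2 f x / 2 * k ^ 2 * h
        + iteratedDeriv 3 f x / 6 * k ^ 3 * h ^ 2
        + iteratedDeriv 4 f x / 24 * k ^ 4 * h ^ 3 + h ^ 3 * u h) := by
  have hT := taylor_isLittleO_univ (f := f) (x₀ := x) (n := 4) (contDiff_infty.1 hf 4)
  have hk : Tendsto (fun h : ℝ => x + k * h) (𝓝[>] 0) (𝓝 x) := by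
    have : Continuous (fun h : ℝ => x + k * h) := by fun_prop
    have h2 := this.tendsto 0
    simp only [mul_zero, add_zero] at h2
    exact h2.mono_left nhdsWithin_le_nhds
  have h1 := hT.comp_tendsto hk
  have h2 : ((fun y : ℝ => (y - x) ^ 4) ∘ (fun h : ℝ => x + k * h))
      =O[𝓝[>] 0] (fun h : ℝ => h ^ 4) := by
    have : ((fun y : ℝ => (y - x) ^ 4) ∘ (fun h : ℝ => x + k * h))
      = fun h => k ^ 4 * h ^ 4 := by
      funext h; simp only [Function.comp]; ring
    rw [this]
    exact (Asymptotics.isBigO_refl _ _).const_mul_left _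
  have h3 := (h1.trans_isBigO h2).tendsto_div_nhds_zero
  refine ⟨_, h3, fun h hh => ?_⟩
  have hne : h ≠ 0 := hh.ne'
  simp only [Function.comp, taylor_within_apply, Finset.sum_range_succ, Finset.sum_range_zero,
    iteratedDerivWithin_univ, iteratedDeriv_zero, iteratedDeriv_one, smul_eq_mul, Nat.factorial]
  push_cast
  field_simp
  ring

lemma weno_key (f : ℝ → ℝ) (hf : ContDiff ℝ (⊤ : ℕ∞) f) (x : ℝ) (hx : deriv f x ≠ 0) (c : ℝ) :
    Tendsto (fun h : ℝ =>
        wenoTau f (x + c * h) h / ((wenoTau f (x + c * h) h + wenoBetaBar f (x + c * h) h) * h ^ 3))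
      (𝓝[>] 0)
      (𝓝 (|(13 / 3) * iteratedDeriv 2 f x * iteratedDeriv 3 f x
            - deriv f x * iteratedDeriv 4 f x| / (deriv f x) ^ 2)) := by
  obtain ⟨p, hp, Hp⟩ := weno_taylor_aux f hf x (c - 2)
  obtain ⟨q, hq, Hq⟩ := weno_taylor_aux f hf x (c - 1)
  obtain ⟨r, hr, Hr⟩ := weno_taylor_aux f hf x c
  obtain ⟨s, hs, Hs⟩ := weno_taylor_aux f hf x (c + 1)
  obtain ⟨t, ht, Ht⟩ := weno_taylor_aux f hf x (c + 2)
  generalize deriv f x = a at *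
  generalize iteratedDeriv 2 f x = b2 at *
  generalize iteratedDeriv 3 f x = d6 at *
  generalize iteratedDeriv 4 f x = e24 at *
  obtain ⟨b, rfl⟩ : ∃ b, b2 = 2 * b := ⟨b2 / 2, by ring⟩
  obtain ⟨d, rfl⟩ : ∃ d, d6 = 6 * d := ⟨d6 / 6, by ring⟩
  obtain ⟨e, rfl⟩ : ∃ e, e24 = 24 * e := ⟨e24 / 24, by ring⟩
  have h0 : Tendsto (fun h : ℝ => h) (𝓝[>] 0) (𝓝 0) := tendsto_id.mono_left nhdsWithin_le_nhds
  have hall := h0.prodMk_nhds (hp.prodMk_nhds (hq.prodMk_nhds (hr.prodMk_nhds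
    (hs.prodMk_nhds ht))))
  let G : ℝ → ℝ → ℝ → ℝ := fun k h u => a * k + b * k ^ 2 * h + d * k ^ 3 * h ^ 2
    + e * k ^ 4 * h ^ 3 + h ^ 3 * u
  let T : ℝ × ℝ × ℝ × ℝ × ℝ × ℝ → ℝ := fun ⟨h, p, q, r, s, t⟩ =>
    1 / 4 * (24 * e + p - 4 * q + 6 * r - 4 * s + t)
      * (-4 * a + b * h * (-8 * c) + d * h ^ 2 * (-12 * c ^ 2 + 8)
        + e * h ^ 3 * (-16 * c ^ 3 + 32 * c) + h ^ 3 * (t - 4 * s + 4 * q - p))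
    + 13 / 12 * (12 * d + 48 * c * e * h + h * (t - 2 * s + 2 * q - p))
      * (4 * b + 12 * c * d * h + e * h ^ 2 * (24 * c ^ 2 + 28)
        + h ^ 2 * (t - 2 * s + 2 * r - 2 * q + p))
  let B : ℝ × ℝ × ℝ × ℝ × ℝ × ℝ → ℝ := fun ⟨h, p, q, r, s, t⟩ =>
    ((1 / 4) * (G (c - 2) h p - 4 * G (c - 1) h q + 3 * G c h r) ^ 2
       + (13 / 12) * (G (c - 2) h p - 2 * G (c - 1) h q + G c h r) ^ 2
    + ((1 / 4) * (G (c + 1) h s - G (c - 1) h q) ^ 2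
       + (13 / 12) * (G (c - 1) h q - 2 * G c h r + G (c + 1) h s) ^ 2)
    + ((1 / 4) * (3 * G c h r - 4 * G (c + 1) h s + G (c + 2) h t) ^ 2
       + (13 / 12) * (G c h r - 2 * G (c + 1) h s + G (c + 2) h t) ^ 2)) / 3
  have hTc : Continuous T := by fun_prop
  have hBc : Continuous B := by fun_prop
  have hT := (hTc.tendsto (0, 0, 0, 0, 0, 0)).comp hall
  have hB := (hBc.tendsto (0, 0, 0, 0, 0, 0)).comp hall
  have hT0 : T (0, 0, 0, 0, 0, 0) = 13 / 3 * (2 * b) * (6 * d) - a * (24 * e) := by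
    simp only [T]; ring
  have hB0 : B (0, 0, 0, 0, 0, 0) = a ^ 2 := by
    simp only [B, G]; ring
  rw [hT0] at hT
  rw [hB0] at hB
  have hfin := hT.abs.div ((hT.abs.mul (h0.pow 3)).add hB) (by
    simpa using hx)
  simp only [ne_eq, OfNat.ofNat_ne_zero, not_false_eq_true, zero_pow, mul_zero, zero_add] at hfin
  refine hfin.congr' ?_
  filter_upwards [self_mem_nhdsWithin] with h hh
  have hh : 0 < h := hh
  have e1 : x + c * h - 2 * h = x + (c - 2) * h := by ring
  have e2 : x + c * h - h = x + (c - 1) * h := by ring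
  have e3 : x + c * h + h = x + (c + 1) * h := by ring
  have e4 : x + c * h + 2 * h = x + (c + 2) * h := by ring
  have hτ : wenoTau f (x + c * h) h = h ^ 5 * |T (h, p h, q h, r h, s h, t h)| := by
    rw [← abs_of_pos (pow_pos hh 5), ← abs_mul, wenoTau]
    congr 1
    simp only [wenoBeta, e1, e2, e3, e4, Hp h hh, Hq h hh, Hr h hh, Hs h hh, Ht h hh, T]
    ring
  have hβ : wenoBetaBar f (x + c * h) h = h ^ 2 * B (h, p h, q h, r h, s h, t h) := by
    simp only [wenoBetaBar, wenoBeta, e1, e2, e3, e4, Hp h hh, Hq h hh, Hr h hh, Hs h hh,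
      Ht h hh, B, G]
    ring
  rw [hτ, hβ]
  simp only [Function.comp, Pi.div_apply]
  generalize |T (h, p h, q h, r h, s h, t h)| = τ
  generalize B (h, p h, q h, r h, s h, t h) = β
  rw [show (h ^ 5 * τ + h ^ 2 * β) * h ^ 3 = h ^ 5 * (τ * h ^ 3 + β) by ring]
  rw [mul_div_mul_left _ _ (pow_pos hh 5).ne']

lemma weno_bound_aux (A B : ℝ → ℝ) (L : ℝ)
    (h : Tendsto (fun y => A y / (B y * y ^ 3)) (𝓝[>] 0) (𝓝 L)) :
    ∀ᶠ y in 𝓝[>] (0 : ℝ), |A y / B y| ≤ (|L| + 1) * y ^ 3 := by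
  filter_upwards [h.abs.eventually_lt_const (lt_add_one |L|), self_mem_nhdsWithin] with y hy h0
  have h0 : 0 < y := h0
  have h3 : 0 < y ^ 3 := pow_pos h0 3
  rw [← div_div, abs_div, abs_of_pos h3, div_lt_iff₀ h3] at hy
  exact hy.le

/-- away from critical points (`f′(x) ≠ 0`), for both signs,
`τ^±/((τ^± + β̄^±)·Δx³) → |(13/3)f″f‴ − f′f⁽⁴⁾|/(f′)²` as `Δx → 0⁺`; in
particular the WENO-ZC accelerating factor `τ^±/(τ^± + β̄^±)` is `O(Δx³)`. -/
theorem weno_zc_accelerator_no_critical_point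
    (f : ℝ → ℝ) (hf : ContDiff ℝ (⊤ : ℕ∞) f) (x : ℝ) (hx : deriv f x ≠ 0) :
    Tendsto (fun Δx : ℝ =>
        wenoTau f x Δx / ((wenoTau f x Δx + wenoBetaBar f x Δx) * Δx ^ 3))
      (𝓝[>] 0)
      (𝓝 (|(13 / 3) * iteratedDeriv 2 f x * iteratedDeriv 3 f x
            - deriv f x * iteratedDeriv 4 f x| / (deriv f x) ^ 2)) ∧
    Tendsto (fun Δx : ℝ =>
        wenoTau f (x - Δx) Δx /
          ((wenoTau f (x - Δx) Δx + wenoBetaBar f (x - Δx) Δx) * Δx ^ 3))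
      (𝓝[>] 0)
      (𝓝 (|(13 / 3) * iteratedDeriv 2 f x * iteratedDeriv 3 f x
            - deriv f x * iteratedDeriv 4 f x| / (deriv f x) ^ 2)) ∧
    (∃ C > (0 : ℝ), ∃ δ > (0 : ℝ), ∀ Δx : ℝ, 0 < Δx → Δx < δ →
      |wenoTau f x Δx / (wenoTau f x Δx + wenoBetaBar f x Δx)| ≤ C * Δx ^ 3 ∧
      |wenoTau f (x - Δx) Δx / (wenoTau f (x - Δx) Δx + wenoBetaBar f (x - Δx) Δx)|
        ≤ C * Δx ^ 3) := by
  have h1 := weno_key f hf x hx 0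
  have h2 := weno_key f hf x hx (-1)
  simp only [zero_mul, add_zero] at h1
  simp only [neg_one_mul, ← sub_eq_add_neg] at h2
  have hb := (weno_bound_aux _ _ _ h1).and (weno_bound_aux _ _ _ h2)
  obtain ⟨δ, hδ, H⟩ := mem_nhdsGT_iff_exists_Ioo_subset.1 hb
  refine ⟨h1, h2, _, ?_, δ, hδ, fun y h0 hy => H ⟨h0, hy⟩⟩
  positivity
end
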